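/- arXiv:2502.09942 — 2 statements merged into one kernel-verified Lean document; each statement's English description precedes it below -/
import Mathlib

section
/- Let p > 1 and q = p/(p-1). The constant π/sin(π/p) in the Hardy–Hilbert inequality is best possible: for every ε > 0 there exist nonnegative measurable functions f ∈ L^p(0,∞) and g ∈ L^q(0,∞), not almost everywhere zero, such that ∫₀^∞∫₀^∞ f(x)g(y)/(x+y) dx dy > (π/sin(π/p) − ε) · (∫₀^∞ f(x)^p dx)^{1/p} · (∫₀^∞ g(y)^q dy)^{1/q}. -/
open MeasureTheory Set ENNReal

theorem lintegral_rpow_mul_exp_neg_mul_Ioi {a r : ℝ} (ha : 0 < a) (hr : 0 < r) :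
    ∫⁻ t in Ioi (0 : ℝ), ENNReal.ofReal (t ^ (a - 1) * Real.exp (-(r * t))) =
      ENNReal.ofReal ((1 / r) ^ a * Real.Gamma a) := by
  have hI := Real.integral_rpow_mul_exp_neg_mul_Ioi ha hr
  have hG := Real.Gamma_pos_of_pos ha
  have hpos : 0 < (1 / r) ^ a * Real.Gamma a := by positivity
  rw [← hI, ofReal_integral_eq_lintegral_ofReal (.of_integral_ne_zero (hI ▸ hpos.ne'))]
  filter_upwards [ae_restrict_mem measurableSet_Ioi] with t (ht : 0 < t)
  simp only [Pi.zero_apply]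
  positivity

theorem lintegral_rpow_neg_div_add_one_Ioi {s : ℝ} (hs0 : 0 < s) (hs1 : s < 1) :
    ∫⁻ t in Ioi (0 : ℝ), ENNReal.ofReal (t ^ (-s) / (t + 1)) =
      ENNReal.ofReal (Real.pi / Real.sin (Real.pi * s)) := by
  have hs : 0 < 1 - s := sub_pos.2 hs1
  have hG := Real.Gamma_pos_of_pos hs0
  have hG' := Real.Gamma_pos_of_pos hs
  calc
    _ = ∫⁻ t in Ioi (0 : ℝ), ∫⁻ u in Ioi (0 : ℝ),
          ENNReal.ofReal (t ^ (-s) * Real.exp (-((t + 1) * u))) := by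
      refine setLIntegral_congr_fun measurableSet_Ioi fun t (ht : 0 < t) ↦ ?_
      have h := lintegral_rpow_mul_exp_neg_mul_Ioi one_pos (by positivity : 0 < t + 1)
      simp only [sub_self, Real.rpow_zero, one_mul, Real.rpow_one, Real.Gamma_one, mul_one] at h
      simp_rw [ENNReal.ofReal_mul (Real.rpow_nonneg ht.le (-s))]
      rw [lintegral_const_mul _ (by fun_prop), h, ← ENNReal.ofReal_mul (by positivity)]
      congr 1
      ring
    _ = ∫⁻ u in Ioi (0 : ℝ), ∫⁻ t in Ioi (0 : ℝ),
          ENNReal.ofReal (t ^ (-s) * Real.exp (-((t + 1) * u))) :=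
      lintegral_lintegral_swap (by fun_prop)
    _ = ∫⁻ u in Ioi (0 : ℝ), ENNReal.ofReal (Real.Gamma (1 - s)) *
          ENNReal.ofReal (u ^ (s - 1) * Real.exp (-(1 * u))) := by
      refine setLIntegral_congr_fun measurableSet_Ioi fun u (hu : 0 < u) ↦ ?_
      have h := lintegral_rpow_mul_exp_neg_mul_Ioi hs hu
      have e : ∀ t : ℝ, t ^ (-s) * Real.exp (-((t + 1) * u)) =
          Real.exp (-u) * (t ^ (1 - s - 1) * Real.exp (-(u * t))) := fun t ↦ by
        rw [show -((t + 1) * u) = -u + -(u * t) by ring, Real.exp_add,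
          show 1 - s - 1 = -s by ring]
        ring
      simp_rw [e, ENNReal.ofReal_mul (Real.exp_pos (-u)).le]
      rw [lintegral_const_mul _ (by fun_prop), h, ← ENNReal.ofReal_mul (by positivity),
        ← ENNReal.ofReal_mul hG'.le, one_div, Real.inv_rpow hu.le, ← Real.rpow_neg hu.le,
        neg_sub, one_mul]
      congr 1
      ring
    _ = _ := by
      rw [lintegral_const_mul _ (by fun_prop), lintegral_rpow_mul_exp_neg_mul_Ioi hs0 one_pos,
        ← ENNReal.ofReal_mul hG'.le, ← Real.Gamma_mul_Gamma_one_sub]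
      simp [mul_comm]

theorem lintegral_inv_Ioc {a b : ℝ} (ha : 0 < a) (hab : a ≤ b) :
    ∫⁻ x in Ioc a b, ENNReal.ofReal x⁻¹ = ENNReal.ofReal (Real.log (b / a)) := by
  rw [← integral_inv_of_pos ha (ha.trans_le hab), intervalIntegral.integral_of_le hab,
    ofReal_integral_eq_lintegral_ofReal]
  · refine (intervalIntegrable_iff_integrableOn_Ioc_of_le hab).1 ?_
    refine intervalIntegral.intervalIntegrable_inv (fun x hx ↦ ?_) continuousOn_id
    rw [uIcc_of_le hab] at hx
    exact (ha.trans_le hx.1).ne'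
  · filter_upwards [ae_restrict_mem measurableSet_Ioc] with x hx
    exact inv_nonneg.2 (ha.le.trans hx.1.le)

/-- The `L^r` norm integral of `x ^ (-1/r)` truncated to an interval. -/
theorem lintegral_indicator_rpow_rpow {a b r : ℝ} (ha : 0 < a) (hab : a ≤ b) (hr : 0 < r) :
    ∫⁻ x in Ioi (0 : ℝ),
        (Ioc a b).indicator (fun x ↦ ENNReal.ofReal (x ^ (-(1 / r)))) x ^ r =
      ENNReal.ofReal (Real.log (b / a)) := by
  have e : ∀ x, (Ioc a b).indicator (fun x ↦ ENNReal.ofReal (x ^ (-(1 / r)))) x ^ r =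
      (Ioc a b).indicator (fun x ↦ ENNReal.ofReal x⁻¹) x := fun x ↦ by
    by_cases hx : x ∈ Ioc a b
    · have hx0 : 0 < x := ha.trans hx.1
      rw [indicator_of_mem hx, indicator_of_mem hx,
        ENNReal.ofReal_rpow_of_nonneg (by positivity) hr.le, ← Real.rpow_mul hx0.le,
        show -(1 / r) * r = -1 by field_simp, Real.rpow_neg_one]
    · simp [hx, hr]
  simp_rw [e]
  rw [setLIntegral_indicator measurableSet_Ioc,
    inter_eq_left.2 (Ioc_subset_Ioi_self.trans (Ioi_subset_Ioi ha.le)), lintegral_inv_Ioc ha hab]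

theorem exists_lt_lintegral_Ioc_inv {φ : ℝ → ℝ≥0∞} (hφ : Measurable φ) {k : ℝ≥0∞}
    (hk : k < ∫⁻ t in Ioi (0 : ℝ), φ t) :
    ∃ A : ℝ, 1 < A ∧ k < ∫⁻ t in Ioc A⁻¹ A, φ t := by
  have hc : AECover (volume.restrict (Ioi (0 : ℝ))) Filter.atTop
      fun A : ℝ ↦ Ioi A⁻¹ ∩ Iic A :=
    (aecover_Ioi_of_Ioi tendsto_inv_atTop_zero).inter (aecover_Iic Filter.tendsto_id)
  obtain ⟨A, hA, hA1⟩ := (((hc.lintegral_tendsto_of_countably_generated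
    hφ.aemeasurable).eventually_const_lt hk).and (Filter.eventually_gt_atTop 1)).exists
  exact ⟨A, hA1, hA.trans_le
    (lintegral_mono' (Measure.restrict_mono_measure Measure.restrict_le_self _) le_rfl)⟩

/-- Rescaling `x = y * t` in the inner Hilbert integral. -/
theorem rpow_mul_lintegral_le_lintegral_div_add {s a b c d y : ℝ} (hc : 0 < c) (hy : 0 < y)
    (hay : a ≤ y * c) (hyb : y * d ≤ b) :
    ENNReal.ofReal (y ^ (-s)) * ∫⁻ t in Ioc c d, ENNReal.ofReal (t ^ (-s) / (t + 1)) ≤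
      ∫⁻ x in Ioc a b, ENNReal.ofReal (x ^ (-s)) / ENNReal.ofReal (x + y) := by
  have hsub : (fun t ↦ y * t) '' Ioc c d ⊆ Ioc a b := by
    rintro _ ⟨t, ht, rfl⟩
    exact ⟨hay.trans_lt (mul_lt_mul_of_pos_left ht.1 hy),
      (mul_le_mul_of_nonneg_left ht.2 hy.le).trans hyb⟩
  refine le_trans (le_of_eq ?_) (lintegral_mono_set hsub)
  rw [lintegral_image_eq_lintegral_abs_deriv_mul (f' := fun _ ↦ y) measurableSet_Ioc
      (fun t _ ↦ by simpa using ((hasDerivAt_id t).const_mul y).hasDerivWithinAt)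
      (mul_right_injective₀ hy.ne').injOn,
    ← lintegral_const_mul _ (by fun_prop)]
  refine setLIntegral_congr_fun measurableSet_Ioc fun t ht ↦ ?_
  have ht0 : 0 < t := hc.trans ht.1
  rw [← ENNReal.ofReal_div_of_pos (by positivity), ← ENNReal.ofReal_mul (by positivity),
    ← ENNReal.ofReal_mul (by positivity), abs_of_pos hy, Real.mul_rpow hy.le ht0.le]
  congr 1
  field_simp

theorem exists_mul_rpow_lt {c k r : ℝ} (hck : c < k) :
    ∃ n : ℕ, 0 < n ∧ c * (((n : ℝ) + 2) / n) ^ r < k := by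
  have h1 : Filter.Tendsto (fun n : ℕ ↦ ((n : ℝ) + 2) / n) Filter.atTop (nhds 1) := by
    have := (tendsto_const_div_atTop_nhds_zero_nat (2 : ℝ)).const_add 1
    rw [add_zero] at this
    refine this.congr' ?_
    filter_upwards [Filter.eventually_gt_atTop 0] with n hn
    field_simp
  have h2 := (h1.rpow_const (p := r) (Or.inl one_ne_zero)).const_mul c
  rw [Real.one_rpow, mul_one] at h2
  obtain ⟨n, hn, hn0⟩ :=
    ((h2.eventually_lt_const hck).and (Filter.eventually_gt_atTop 0)).exists
  exact ⟨n, hn0, hn⟩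

/-- Sharpness of the constant `π/sin(π/p)` in the Hardy–Hilbert inequality:
for every `ε > 0` there are nonnegative measurable `f ∈ L^p(0,∞)`, `g ∈ L^q(0,∞)`,
not a.e. zero, for which the bilinear form exceeds
`(π/sin(π/p) − ε) ‖f‖_p ‖g‖_q`. -/
theorem stmt_1 (p q : ℝ) (hp : 1 < p) (hq : q = p / (p - 1)) :
    ∀ ε : ℝ, 0 < ε →
      ∃ f g : ℝ → ℝ≥0∞, Measurable f ∧ Measurable g ∧
        (∫⁻ x in Ioi (0 : ℝ), f x ^ p < ⊤) ∧
        (∫⁻ y in Ioi (0 : ℝ), g y ^ q < ⊤) ∧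
        ¬ (∀ᵐ x ∂(volume.restrict (Ioi (0 : ℝ))), f x = 0) ∧
        ¬ (∀ᵐ y ∂(volume.restrict (Ioi (0 : ℝ))), g y = 0) ∧
        ENNReal.ofReal (Real.pi / Real.sin (Real.pi / p) - ε) *
            (∫⁻ x in Ioi (0 : ℝ), f x ^ p) ^ (1 / p) *
            (∫⁻ y in Ioi (0 : ℝ), g y ^ q) ^ (1 / q) <
          ∫⁻ y in Ioi (0 : ℝ), ∫⁻ x in Ioi (0 : ℝ),
            f x * g y / ENNReal.ofReal (x + y) := by
  intro ε hε
  have hp0 : 0 < p := one_pos.trans hp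
  have hpq : 1 / p + 1 / q = 1 := by
    have : p - 1 ≠ 0 := (sub_pos.2 hp).ne'
    rw [hq]
    field_simp
    ring
  have hq0 : 0 < q := hq ▸ div_pos hp0 (sub_pos.2 hp)
  have hs0 : 0 < 1 / p := by positivity
  have hs1 : 1 / p < 1 := (div_lt_one hp0).2 hp
  have hK : 0 < Real.pi / Real.sin (Real.pi / p) :=
    div_pos Real.pi_pos (Real.sin_pos_of_pos_of_lt_pi (by positivity)
      (div_lt_self Real.pi_pos hp))
  obtain ⟨k, hck, hkK⟩ := exists_between
    (max_lt (sub_lt_self (Real.pi / Real.sin (Real.pi / p)) hε) hK)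
  set c := max (Real.pi / Real.sin (Real.pi / p) - ε) 0 with hc
  have hc0 : 0 ≤ c := le_max_right _ _
  have hk0 : 0 < k := hc0.trans_lt hck
  obtain ⟨A, hA1, hA⟩ := exists_lt_lintegral_Ioc_inv
    (φ := fun t ↦ ENNReal.ofReal (t ^ (-(1 / p)) / (t + 1))) (by fun_prop)
    (k := ENNReal.ofReal k) (by
      rw [lintegral_rpow_neg_div_add_one_Ioi hs0 hs1, mul_one_div]
      exact (ENNReal.ofReal_lt_ofReal_iff hK).2 hkK)
  obtain ⟨n, hn0, hn⟩ := exists_mul_rpow_lt (r := 1 / p) hck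
  have hA0 : 0 < A := one_pos.trans hA1
  have hℓ : 0 < Real.log A := Real.log_pos hA1
  have hnR : (0 : ℝ) < n := Nat.cast_pos.2 hn0
  have hF := lintegral_indicator_rpow_rpow one_pos (one_le_pow₀ hA1.le : 1 ≤ A ^ (n + 2)) hp0
  have hAn : A ≤ A ^ (n + 1) := le_self_pow₀ hA1.le n.succ_ne_zero
  have hG := lintegral_indicator_rpow_rpow hA0 hAn hq0
  have hL : Real.log (A ^ (n + 1) / A) = n * Real.log A := by
    rw [pow_succ, mul_div_cancel_right₀ _ hA0.ne', Real.log_pow]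
  rw [div_one, Real.log_pow, Nat.cast_add, Nat.cast_ofNat] at hF
  rw [hL] at hG
  have hne : ∀ {r : ℝ} {h : ℝ → ℝ≥0∞} {v : ℝ}, 0 < r → 0 < v →
      ∫⁻ x in Ioi (0 : ℝ), h x ^ r = ENNReal.ofReal v →
      ¬ ∀ᵐ x ∂(volume.restrict (Ioi (0 : ℝ))), h x = 0 := fun hr hv hv' h0 ↦ by
    rw [lintegral_congr_ae (h0.mono fun x hx ↦ by rw [hx, ENNReal.zero_rpow_of_pos hr]),
      lintegral_zero] at hv'
    exact (ENNReal.ofReal_pos.2 hv).ne hv'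
  refine ⟨_, _, Measurable.indicator (by fun_prop) measurableSet_Ioc,
    Measurable.indicator (by fun_prop) measurableSet_Ioc, hF ▸ ENNReal.ofReal_lt_top,
    hG ▸ ENNReal.ofReal_lt_top, hne hp0 (by positivity) hF, hne hq0 (by positivity) hG, ?_⟩
  rw [hF, hG]
  calc
    _ = ENNReal.ofReal (c * (((n : ℝ) + 2) / n) ^ (1 / p) * (n * Real.log A)) := by
      rw [show ENNReal.ofReal (Real.pi / Real.sin (Real.pi / p) - ε) = ENNReal.ofReal c by
          rw [hc, ENNReal.ofReal_max, ENNReal.ofReal_zero, max_eq_left zero_le],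
        ENNReal.ofReal_rpow_of_nonneg (by positivity) (by positivity),
        ENNReal.ofReal_rpow_of_nonneg (by positivity) (by positivity),
        ← ENNReal.ofReal_mul hc0, ← ENNReal.ofReal_mul (by positivity),
        show ((n : ℝ) + 2) * Real.log A = ((n : ℝ) + 2) / n * (n * Real.log A) by field_simp,
        Real.mul_rpow (by positivity) (by positivity), mul_assoc, mul_assoc, mul_assoc,
        ← Real.rpow_add (by positivity), hpq, Real.rpow_one]
    _ < ENNReal.ofReal (k * (n * Real.log A)) :=
      (ENNReal.ofReal_lt_ofReal_iff (by positivity)).2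
        (mul_lt_mul_of_pos_right hn (by positivity))
    _ = ∫⁻ y in Ioc A (A ^ (n + 1)), ENNReal.ofReal k * ENNReal.ofReal y⁻¹ := by
      rw [lintegral_const_mul _ (by fun_prop), lintegral_inv_Ioc hA0 hAn, hL,
        ENNReal.ofReal_mul hk0.le]
    _ ≤ ∫⁻ y in Ioc A (A ^ (n + 1)), ∫⁻ x in Ioi (0 : ℝ), _ := by
      refine setLIntegral_mono' measurableSet_Ioc fun y hy ↦ ?_
      have hy0 : 0 < y := hA0.trans hy.1
      have hscale := rpow_mul_lintegral_le_lintegral_div_add (s := 1 / p) (a := 1)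
        (b := A ^ (n + 2)) (inv_pos.2 hA0) hy0
        (by rw [← div_eq_mul_inv]; exact (one_le_div hA0).2 hy.1.le)
        (by rw [pow_succ _ (n + 1)]; exact mul_le_mul_of_nonneg_right hy.2 hA0.le)
      calc
        _ = ENNReal.ofReal (y ^ (-(1 / q))) *
            (ENNReal.ofReal (y ^ (-(1 / p))) * ENNReal.ofReal k) := by
          rw [← mul_assoc, ← ENNReal.ofReal_mul (by positivity : 0 ≤ y ^ (-(1 / q))),
            ← Real.rpow_add hy0,
            ← neg_add, add_comm (1 / q), hpq, Real.rpow_neg_one, mul_comm]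
        _ ≤ ENNReal.ofReal (y ^ (-(1 / q))) * ∫⁻ x in Ioc 1 (A ^ (n + 2)),
              ENNReal.ofReal (x ^ (-(1 / p))) / ENNReal.ofReal (x + y) := by
          gcongr
          exact (mul_le_mul_right hA.le _).trans hscale
        _ = ∫⁻ x in Ioc 1 (A ^ (n + 2)), ENNReal.ofReal (y ^ (-(1 / q))) *
              (ENNReal.ofReal (x ^ (-(1 / p))) / ENNReal.ofReal (x + y)) :=
          (lintegral_const_mul _ (by fun_prop)).symm
        _ = ∫⁻ x in Ioc 1 (A ^ (n + 2)), _ := by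
          refine setLIntegral_congr_fun measurableSet_Ioc fun x hx ↦ ?_
          rw [indicator_of_mem hx, indicator_of_mem hy, mul_comm, ENNReal.mul_div_right_comm]
        _ ≤ _ := lintegral_mono_set fun x hx ↦ one_pos.trans hx.1
    _ ≤ _ := lintegral_mono_set fun y hy ↦ hA0.trans hy.1
end

section
/- Let p > 1, k > 1, 1/p + 1/q = 1, 1/k + 1/m = 1, and λ > 0. Then for all nonnegative measurable functions f ∈ L^p(0,∞) and g ∈ L^q(0,∞): ∫₀^∞∫₀^∞ (x^{−1+λ/k+1/p} y^{−1+λ/m+1/q} / (x^λ + y^λ)) f(x) g(y) dx dy ≤ (π/(λ sin(π/m))) · (∫₀^∞ f(x)^p dx)^{1/p} · (∫₀^∞ g(y)^q dy)^{1/q}. -/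
open MeasureTheory Set ENNReal

/-- Schur test: if the kernel factors as `u ^ (1 / p) * v ^ (1 / q)`, where the partial integrals
of `u` and `v` are at most `C`, then its bilinear form has norm at most `C`. -/
theorem lintegral_lintegral_kernel_mul_le {α β : Type*} [MeasurableSpace α] [MeasurableSpace β]
    {μ : Measure α} {ν : Measure β} [SFinite μ] [SFinite ν] {p q : ℝ} (hpq : p.HolderConjugate q)
    {K u v : α → β → ℝ≥0∞} {C : ℝ≥0∞} {f : α → ℝ≥0∞} {g : β → ℝ≥0∞}
    (hu : Measurable (Function.uncurry u)) (hv : Measurable (Function.uncurry v))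
    (hK : ∀ᵐ y ∂ν, ∀ᵐ x ∂μ, K x y = u x y ^ (1 / p) * v x y ^ (1 / q))
    (huC : ∀ᵐ x ∂μ, ∫⁻ y, u x y ∂ν ≤ C) (hvC : ∀ᵐ y ∂ν, ∫⁻ x, v x y ∂μ ≤ C)
    (hf : Measurable f) (hg : Measurable g) :
    ∫⁻ y, ∫⁻ x, K x y * (f x * g y) ∂μ ∂ν ≤
      C * (∫⁻ x, f x ^ p ∂μ) ^ (1 / p) * (∫⁻ y, g y ^ q ∂ν) ^ (1 / q) := by
  have hp := hpq.pos
  have hq := hpq.symm.pos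
  set F : α × β → ℝ≥0∞ := fun z => u z.1 z.2 ^ (1 / p) * f z.1 with hF
  set G : α × β → ℝ≥0∞ := fun z => v z.1 z.2 ^ (1 / q) * g z.2 with hG
  have hu' : Measurable fun z : α × β => u z.1 z.2 := hu
  have hv' : Measurable fun z : α × β => v z.1 z.2 := hv
  have hFm : Measurable F := (hu'.pow_const _).mul (hf.comp measurable_fst)
  have hGm : Measurable G := (hv'.pow_const _).mul (hg.comp measurable_snd)
  have hFp : ∀ z, F z ^ p = u z.1 z.2 * f z.1 ^ p := fun z => by
    rw [hF, ENNReal.mul_rpow_of_nonneg _ _ hp.le, ← ENNReal.rpow_mul, one_div_mul_cancel hp.ne',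
      ENNReal.rpow_one]
  have hGq : ∀ z, G z ^ q = v z.1 z.2 * g z.2 ^ q := fun z => by
    rw [hG, ENNReal.mul_rpow_of_nonneg _ _ hq.le, ← ENNReal.rpow_mul, one_div_mul_cancel hq.ne',
      ENNReal.rpow_one]
  have hFint : ∫⁻ z, F z ^ p ∂(μ.prod ν) ≤ C * ∫⁻ x, f x ^ p ∂μ := by
    rw [lintegral_prod _ (hFm.pow_const p).aemeasurable,
      ← lintegral_const_mul _ (hf.pow_const p)]
    refine lintegral_mono_ae (huC.mono fun x hx => ?_)
    simp only [hFp]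
    rw [lintegral_mul_const _ hu.of_uncurry_left]
    gcongr
  have hGint : ∫⁻ z, G z ^ q ∂(μ.prod ν) ≤ C * ∫⁻ y, g y ^ q ∂ν := by
    rw [lintegral_prod_symm _ (hGm.pow_const q).aemeasurable,
      ← lintegral_const_mul _ (hg.pow_const q)]
    refine lintegral_mono_ae (hvC.mono fun y hy => ?_)
    simp only [hGq]
    rw [lintegral_mul_const _ hv.of_uncurry_right]
    gcongr
  calc ∫⁻ y, ∫⁻ x, K x y * (f x * g y) ∂μ ∂ν
      = ∫⁻ y, ∫⁻ x, (F * G) (x, y) ∂μ ∂ν := by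
        refine lintegral_congr_ae (hK.mono fun y hy => lintegral_congr_ae (hy.mono fun x hx => ?_))
        simp only [hF, hG, Pi.mul_apply, hx]
        ring
    _ = ∫⁻ z, (F * G) z ∂(μ.prod ν) :=
        (lintegral_prod_symm _ (hFm.mul hGm).aemeasurable).symm
    _ ≤ (∫⁻ z, F z ^ p ∂(μ.prod ν)) ^ (1 / p) * (∫⁻ z, G z ^ q ∂(μ.prod ν)) ^ (1 / q) :=
        ENNReal.lintegral_mul_le_Lp_mul_Lq _ hpq hFm.aemeasurable hGm.aemeasurable
    _ ≤ (C * ∫⁻ x, f x ^ p ∂μ) ^ (1 / p) * (C * ∫⁻ y, g y ^ q ∂ν) ^ (1 / q) := by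
        gcongr
    _ = C ^ (1 / p + 1 / q) * (∫⁻ x, f x ^ p ∂μ) ^ (1 / p) * (∫⁻ y, g y ^ q ∂ν) ^ (1 / q) := by
        rw [ENNReal.mul_rpow_of_nonneg _ _ (by positivity),
          ENNReal.mul_rpow_of_nonneg _ _ (by positivity),
          ENNReal.rpow_add_of_nonneg _ _ (by positivity) (by positivity)]
        ring
    _ = C * (∫⁻ x, f x ^ p ∂μ) ^ (1 / p) * (∫⁻ y, g y ^ q ∂ν) ^ (1 / q) := by
        rw [one_div, one_div, hpq.inv_add_inv_eq_one, ENNReal.rpow_one]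

/-- Generalized Gamma integral, as a Lebesgue integral. -/
theorem lintegral_rpow_mul_exp_neg_mul_rpow {r s b : ℝ} (hr : 0 < r) (hs : -1 < s) (hb : 0 < b) :
    ∫⁻ x in Ioi (0 : ℝ), ENNReal.ofReal (x ^ s * Real.exp (-b * x ^ r)) =
      ENNReal.ofReal (b ^ (-(s + 1) / r) * (1 / r) * Real.Gamma ((s + 1) / r)) := by
  have hI := integral_rpow_mul_exp_neg_mul_rpow hr hs hb
  have hne : ∫ x in Ioi (0 : ℝ), x ^ s * Real.exp (-b * x ^ r) ≠ 0 := by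
    rw [hI]
    have := Real.Gamma_pos_of_pos (div_pos (by linarith : 0 < s + 1) hr)
    positivity
  rw [← hI, ofReal_integral_eq_lintegral_ofReal (not_imp_comm.1 integral_undef hne)]
  filter_upwards [ae_restrict_mem measurableSet_Ioi] with x (hx : 0 < x)
  positivity

theorem lintegral_exp_neg_mul {b : ℝ} (hb : 0 < b) :
    ∫⁻ x in Ioi (0 : ℝ), ENNReal.ofReal (Real.exp (-b * x)) = ENNReal.ofReal (1 / b) := by
  have h := lintegral_rpow_mul_exp_neg_mul_rpow one_pos (by norm_num : (-1 : ℝ) < 0) hb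
  simpa [Real.rpow_neg_one] using h

/-- The Mellin transform of `1 / (x ^ l + c)`. -/
theorem lintegral_rpow_div_rpow_add {l t c : ℝ} (hl : 0 < l) (ht0 : 0 < t) (ht1 : t < 1)
    (hc : 0 < c) :
    ∫⁻ x in Ioi (0 : ℝ), ENNReal.ofReal (x ^ (-1 + l * t) / (x ^ l + c)) =
      ENNReal.ofReal (c ^ (t - 1) * (Real.pi / (l * Real.sin (Real.pi * t)))) := by
  have hlt : 0 < l * t := mul_pos hl ht0
  have hΓ := Real.Gamma_pos_of_pos ht0
  calc ∫⁻ x in Ioi (0 : ℝ), ENNReal.ofReal (x ^ (-1 + l * t) / (x ^ l + c))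
      = ∫⁻ x in Ioi (0 : ℝ), ∫⁻ w in Ioi (0 : ℝ),
          ENNReal.ofReal (x ^ (-1 + l * t) * Real.exp (-(x ^ l + c) * w)) := by
        refine setLIntegral_congr_fun measurableSet_Ioi fun x (hx : 0 < x) => ?_
        have hx' : 0 ≤ x ^ (-1 + l * t) := by positivity
        simp only [ENNReal.ofReal_mul hx']
        rw [lintegral_const_mul _ (by fun_prop), lintegral_exp_neg_mul (by positivity),
          ← ENNReal.ofReal_mul hx', mul_one_div]
    _ = ∫⁻ w in Ioi (0 : ℝ), ∫⁻ x in Ioi (0 : ℝ),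
          ENNReal.ofReal (x ^ (-1 + l * t) * Real.exp (-(x ^ l + c) * w)) :=
        lintegral_lintegral_swap (by
          refine Measurable.aemeasurable ?_
          unfold Function.uncurry
          fun_prop)
    _ = ∫⁻ w in Ioi (0 : ℝ), ENNReal.ofReal (Real.Gamma t / l) *
          ENNReal.ofReal (w ^ (-t) * Real.exp (-c * w ^ (1 : ℝ))) := by
        refine setLIntegral_congr_fun measurableSet_Ioi fun w (hw : 0 < w) => ?_
        have he : ∀ x : ℝ, x ^ (-1 + l * t) * Real.exp (-(x ^ l + c) * w) =
            Real.exp (-c * w) * (x ^ (-1 + l * t) * Real.exp (-w * x ^ l)) := fun x => by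
          rw [mul_left_comm, ← Real.exp_add]
          ring_nf
        simp only [he, ENNReal.ofReal_mul (Real.exp_pos _).le]
        rw [lintegral_const_mul _ (by fun_prop),
          lintegral_rpow_mul_exp_neg_mul_rpow hl (by linarith) hw,
          ← ENNReal.ofReal_mul (Real.exp_pos _).le, ← ENNReal.ofReal_mul (by positivity)]
        have h1 : (-1 + l * t + 1) / l = t := by field_simp; ring
        rw [neg_div, h1, Real.rpow_one]
        ring_nf
    _ = ENNReal.ofReal (c ^ (t - 1) * (Real.pi / (l * Real.sin (Real.pi * t)))) := by
        rw [lintegral_const_mul _ (by fun_prop),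
          lintegral_rpow_mul_exp_neg_mul_rpow one_pos (by linarith) hc,
          ← ENNReal.ofReal_mul (by positivity), mul_comm l, ← div_div,
          ← Real.Gamma_mul_Gamma_one_sub]
        ring_nf

/-- The normalised Schur weight has a partial integral independent of the parameter. -/
theorem lintegral_rpow_mul_rpow_div_rpow_add_rpow {l t y : ℝ} (hl : 0 < l) (ht0 : 0 < t)
    (ht1 : t < 1) (hy : 0 < y) :
    ∫⁻ x in Ioi (0 : ℝ),
        ENNReal.ofReal (y ^ (l * (1 - t)) * (x ^ (-1 + l * t) / (x ^ l + y ^ l))) =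
      ENNReal.ofReal (Real.pi / (l * Real.sin (Real.pi * t))) := by
  have hy' : 0 ≤ y ^ (l * (1 - t)) := by positivity
  simp only [ENNReal.ofReal_mul hy']
  rw [lintegral_const_mul _ (by fun_prop), lintegral_rpow_div_rpow_add hl ht0 ht1 (by positivity),
    ← ENNReal.ofReal_mul hy', ← mul_assoc, ← Real.rpow_mul hy.le, ← Real.rpow_add hy]
  rw [show l * (1 - t) + l * (t - 1) = 0 by ring, Real.rpow_zero, one_mul]

/-- The weighted Hardy–Hilbert inequality with kernel `1/(x^λ+y^λ)` rewritten in
unweighted `L^p`–`L^q` form, with the degree `−1` homogeneous kernel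
`x^{−1+λ/k+1/p} y^{−1+λ/m+1/q}/(x^λ + y^λ)`. -/
theorem stmt_4 (p q k m l : ℝ) (hp : 1 < p) (hk : 1 < k)
    (hpq : 1 / p + 1 / q = 1) (hkm : 1 / k + 1 / m = 1) (hl : 0 < l)
    (f g : ℝ → ℝ≥0∞) (hf : Measurable f) (hg : Measurable g)
    (hfp : ∫⁻ x in Ioi (0 : ℝ), f x ^ p < ⊤)
    (hgq : ∫⁻ y in Ioi (0 : ℝ), g y ^ q < ⊤) :
    ∫⁻ y in Ioi (0 : ℝ), ∫⁻ x in Ioi (0 : ℝ),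
        ENNReal.ofReal (x ^ (-1 + l / k + 1 / p) * y ^ (-1 + l / m + 1 / q) /
          (x ^ l + y ^ l)) * (f x * g y) ≤
      ENNReal.ofReal (Real.pi / (l * Real.sin (Real.pi / m))) *
        (∫⁻ x in Ioi (0 : ℝ), f x ^ p) ^ (1 / p) *
        (∫⁻ y in Ioi (0 : ℝ), g y ^ q) ^ (1 / q) := by
  have hconj : p.HolderConjugate q :=
    Real.holderConjugate_iff.2 ⟨hp, by simpa only [one_div] using hpq⟩
  have hk0 : 0 < 1 / k := by positivity
  have hk1 : 1 / k < 1 := (div_lt_one (by linarith)).2 hk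
  have hm : 1 / m = 1 - 1 / k := by linarith
  have hp0 : 0 ≤ 1 / p := hconj.one_div_nonneg
  have hq0 : 0 ≤ 1 / q := hconj.symm.one_div_nonneg
  have hsin : Real.sin (Real.pi * (1 / k)) = Real.sin (Real.pi / m) := by
    rw [← Real.sin_pi_sub, ← mul_one_div Real.pi m, hm]
    ring_nf
  refine lintegral_lintegral_kernel_mul_le hconj
    (u := fun x y => ENNReal.ofReal
      (x ^ (l * (1 - 1 / m)) * (y ^ (-1 + l * (1 / m)) / (y ^ l + x ^ l))))
    (v := fun x y => ENNReal.ofReal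
      (y ^ (l * (1 - 1 / k)) * (x ^ (-1 + l * (1 / k)) / (x ^ l + y ^ l))))
    (by unfold Function.uncurry; fun_prop) (by unfold Function.uncurry; fun_prop)
    ?_ ?_ ?_ hf hg
  · filter_upwards [ae_restrict_mem measurableSet_Ioi] with y (hy : 0 < y)
    filter_upwards [ae_restrict_mem measurableSet_Ioi] with x (hx : 0 < x)
    have hD : 0 < x ^ l + y ^ l := by positivity
    rw [ENNReal.ofReal_rpow_of_nonneg (by positivity) hp0,
      ENNReal.ofReal_rpow_of_nonneg (by positivity) hq0, ← ENNReal.ofReal_mul (by positivity)]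
    congr 1
    rw [add_comm (y ^ l), Real.mul_rpow (by positivity) (by positivity),
      Real.div_rpow (by positivity) hD.le, Real.mul_rpow (by positivity) (by positivity),
      Real.div_rpow (by positivity) hD.le, ← Real.rpow_mul hx.le, ← Real.rpow_mul hx.le,
      ← Real.rpow_mul hy.le, ← Real.rpow_mul hy.le]
    have hq : 1 / q = 1 - 1 / p := by linarith
    have hxe : -1 + l / k + 1 / p = l * (1 - 1 / m) * (1 / p) + (-1 + l * (1 / k)) * (1 / q) := by
      rw [hm, hq]; ring
    have hye : -1 + l / m + 1 / q = (-1 + l * (1 / m)) * (1 / p) + l * (1 - 1 / k) * (1 / q) := by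
      rw [← mul_one_div l m, hm, hq]; ring
    have hDe : x ^ l + y ^ l = (x ^ l + y ^ l) ^ (1 / p) * (x ^ l + y ^ l) ^ (1 / q) := by
      rw [← Real.rpow_add hD, hpq, Real.rpow_one]
    rw [hxe, hye, Real.rpow_add hx, Real.rpow_add hy]
    nth_rw 1 [hDe]
    have hcomm : ∀ a b c d e h : ℝ, a * b * (c * d) / (e * h) = a * (c / e) * (d * (b / h)) := by
      intros; ring
    exact hcomm _ _ _ _ _ _
  · filter_upwards [ae_restrict_mem measurableSet_Ioi] with x (hx : 0 < x)
    rw [lintegral_rpow_mul_rpow_div_rpow_add_rpow hl (by linarith) (by linarith) hx,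
      mul_one_div]
  · filter_upwards [ae_restrict_mem measurableSet_Ioi] with y (hy : 0 < y)
    rw [lintegral_rpow_mul_rpow_div_rpow_add_rpow hl hk0 hk1 hy, hsin]
end
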